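/- Let k₁, k₂, h₁, h₂ be real numbers with k₂ > 0 and 8k₁²k₂² + 3√2·(k₁²h₂ + k₂²h₁) < 0. Let Ω ⊆ ℝ² be open with (0,0) ∈ Ω, and let u₀ : Ω → ℝ be of class C³ with u₀(x,y) = (√2/2)x + (√2/2)y + k₁x² + k₂y² + h₁x³ + h₂y³ + o((x²+y²)^{3/2}) as (x,y) → (0,0). Then there exist δ > 0, a > 0 and a convex function g : (−δ,δ) → (−a,a) with g(0) = 0 such that {(x,y) ∈ (−δ,δ)×(−a,a) : |∇u₀(x,y)| > 1} = {(x,y) ∈ (−δ,δ)×(−a,a) : y > g(x)}. -/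

import Mathlib

open Asymptotics Filter Topology

/-- squared norm of the gradient of `u₀ = u₀(x,y)` -/
noncomputable def gradSq0 (u₀ : ℝ → ℝ → ℝ) (x y : ℝ) : ℝ :=
  (deriv (fun s => u₀ s y) x) ^ 2 + (deriv (fun s => u₀ x s) y) ^ 2

lemma isLittleO_pow_succ_of_hasDerivAt {f f' : ℝ → ℝ} {n : ℕ}
    (hf : ∀ᶠ t in 𝓝 0, HasDerivAt f (f' t) t) (h0 : f 0 = 0)
    (ho : f' =o[𝓝 0] fun t : ℝ => t ^ n) : f =o[𝓝 0] fun t : ℝ => t ^ (n + 1) := by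
  obtain ⟨ε, hε, hball⟩ := Metric.eventually_nhds_iff_ball.1 hf
  have hmem : (0 : ℝ) ∈ Metric.ball (0 : ℝ) ε := Metric.mem_ball_self hε
  have hnhds : 𝓝[Metric.ball (0 : ℝ) ε] (0 : ℝ) = 𝓝 0 := Metric.isOpen_ball.nhdsWithin_eq hmem
  have key := Convex.isLittleO_pow_succ_real (x₀ := 0) (f := f) (f' := f') (n := n)
    (convex_ball (0 : ℝ) ε) hmem (fun t ht => (hball t ht).hasDerivWithinAt)
    (by simpa [hnhds] using ho)
  simpa [hnhds, h0] using key

lemma eq_zero_of_mul_pow_isLittleO {a : ℝ} {n : ℕ}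
    (h : (fun t : ℝ => a * t ^ n) =o[𝓝 0] fun t : ℝ => t ^ n) : a = 0 := by
  by_contra ha
  have h' : (fun t : ℝ => t ^ n) =o[𝓝[≠] 0] fun t : ℝ => t ^ n :=
    ((isLittleO_const_mul_left_iff ha).1 h).mono nhdsWithin_le_nhds
  refine isLittleO_irrefl (Eventually.frequently ?_) h'
  filter_upwards [self_mem_nhdsWithin] with t ht using pow_ne_zero n ht

lemma cubic_coeffs_eq_zero_of_isLittleO {a b c : ℝ}
    (h : (fun t : ℝ => a * t + b * t ^ 2 + c * t ^ 3) =o[𝓝 0] fun t : ℝ => t ^ 3) :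
    a = 0 ∧ b = 0 ∧ c = 0 := by
  have o {m n : ℕ} (hmn : m < n) : (fun t : ℝ => t ^ n) =o[𝓝 0] fun t : ℝ => t ^ m :=
    isLittleO_pow_pow hmn
  have ha : a = 0 := by
    refine eq_zero_of_mul_pow_isLittleO (n := 1) ?_
    refine (((h.trans (o (m := 1) (by norm_num))).sub
      ((o (m := 1) (n := 2) (by norm_num)).const_mul_left b)).sub
      ((o (m := 1) (n := 3) (by norm_num)).const_mul_left c)).congr_left fun t => ?_
    ring
  subst ha
  have hb : b = 0 := by
    refine eq_zero_of_mul_pow_isLittleO (n := 2) ?_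
    refine ((h.trans (o (m := 2) (by norm_num))).sub
      ((o (m := 2) (n := 3) (by norm_num)).const_mul_left c)).congr_left fun t => ?_
    ring
  subst hb
  refine ⟨rfl, rfl, eq_zero_of_mul_pow_isLittleO (n := 3) (h.congr_left fun t => ?_)⟩
  ring

/-- The coefficients of a third-order expansion at `0` are determined by the derivatives. -/
lemma derivs_eq_of_cubic_expansion {f f₁ f₂ : ℝ → ℝ} {L c₁ c₂ c₃ : ℝ}
    (h₁ : ∀ᶠ t in 𝓝 0, HasDerivAt f (f₁ t) t) (h₂ : ∀ᶠ t in 𝓝 0, HasDerivAt f₁ (f₂ t) t)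
    (h₃ : HasDerivAt f₂ L 0)
    (ho : (fun t : ℝ => f t - (c₁ * t + c₂ * t ^ 2 + c₃ * t ^ 3)) =o[𝓝 0] fun t : ℝ => t ^ 3) :
    f₁ 0 = c₁ ∧ f₂ 0 = 2 * c₂ ∧ L = 6 * c₃ := by
  have hf0 : f 0 = 0 := by
    simpa using ho.isBigO.eq_zero_imp.self_of_nhds (by simp)
  have r₂ : (fun t : ℝ => f₂ t - f₂ 0 - L * t) =o[𝓝 0] fun t : ℝ => t ^ 1 := by
    have := hasDerivAt_iff_isLittleO.1 h₃
    simpa [mul_comm] using this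
  have r₁ : (fun t : ℝ => f₁ t - f₁ 0 - f₂ 0 * t - L / 2 * t ^ 2) =o[𝓝 0] fun t : ℝ => t ^ 2 := by
    refine isLittleO_pow_succ_of_hasDerivAt ?_ (by simp) r₂
    filter_upwards [h₂] with t ht
    convert! ((ht.sub_const (f₁ 0)).sub ((hasDerivAt_id t).const_mul (f₂ 0))).sub
      ((hasDerivAt_pow 2 t).const_mul (L / 2)) using 1
    simp; ring
  have r₀ : (fun t : ℝ => f t - f₁ 0 * t - f₂ 0 / 2 * t ^ 2 - L / 6 * t ^ 3)
      =o[𝓝 0] fun t : ℝ => t ^ 3 := by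
    refine isLittleO_pow_succ_of_hasDerivAt ?_ (by simp [hf0]) r₁
    filter_upwards [h₁] with t ht
    convert! ((ht.sub ((hasDerivAt_id t).const_mul (f₁ 0))).sub
      ((hasDerivAt_pow 2 t).const_mul (f₂ 0 / 2))).sub
      ((hasDerivAt_pow 3 t).const_mul (L / 6)) using 1
    simp; ring
  obtain ⟨h1, h2, h3⟩ := cubic_coeffs_eq_zero_of_isLittleO (a := f₁ 0 - c₁) (b := f₂ 0 / 2 - c₂)
    (c := L / 6 - c₃) ((ho.sub r₀).congr_left fun t => by ring)
  exact ⟨by linarith, by linarith, by linarith⟩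

lemma not_isLocalMin_of_second_deriv_neg {f f₁ : ℝ → ℝ} {t L : ℝ}
    (h₁ : ∀ᶠ s in 𝓝 t, HasDerivAt f (f₁ s) s) (h₂ : HasDerivAt f₁ L t) (hL : L < 0) :
    ¬ IsLocalMin f t := by
  intro hmin
  have hd : deriv f =ᶠ[𝓝 t] f₁ := h₁.mono fun s hs => hs.deriv
  have hdd : deriv (deriv f) t = L := by rw [hd.deriv_eq, h₂.deriv]
  have hmax : IsLocalMax f t :=
    isLocalMax_of_deriv_deriv_neg (hdd ▸ hL) hmin.deriv_eq_zero h₁.self_of_nhds.continuousAt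
  have hconst : f =ᶠ[𝓝 t] fun _ => f t := by
    filter_upwards [hmin, hmax] with s hs hs' using le_antisymm hs' hs
  have hz : deriv f =ᶠ[𝓝 t] fun _ => 0 := by
    filter_upwards [hconst.deriv] with s hs using by simpa using hs
  have : deriv (deriv f) t = 0 := by rw [hz.deriv_eq]; simp
  linarith

/-- The derivative of `f` in the direction `w`, as a function of the base point. -/
noncomputable def dirDeriv (w : ℝ × ℝ) (f : ℝ × ℝ → ℝ) (p : ℝ × ℝ) : ℝ := fderiv ℝ f p w

local notation "∂₁" => dirDeriv ((1 : ℝ), (0 : ℝ))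
local notation "∂₂" => dirDeriv ((0 : ℝ), (1 : ℝ))

lemma ContDiffOn.dirDeriv {f : ℝ × ℝ → ℝ} {Ω : Set (ℝ × ℝ)} {m n : WithTop ℕ∞} (hf : ContDiffOn ℝ n f Ω)
    (hΩ : IsOpen Ω) (hmn : m + 1 ≤ n) (w : ℝ × ℝ) : ContDiffOn ℝ m (dirDeriv w f) Ω :=
  (hf.fderiv_of_isOpen hΩ hmn).clm_apply contDiffOn_const

lemma fderiv_apply_eq_dirDeriv (f : ℝ × ℝ → ℝ) (p : ℝ × ℝ) (a b : ℝ) :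
    fderiv ℝ f p (a, b) = a * ∂₁ f p + b * ∂₂ f p := by
  have : ((a, b) : ℝ × ℝ) = a • ((1 : ℝ), (0 : ℝ)) + b • ((0 : ℝ), (1 : ℝ)) := by simp
  rw [this, map_add, map_smul, map_smul]
  rfl

lemma hasDerivAt_comp_line {f : ℝ × ℝ → ℝ} {x y a b t : ℝ}
    (hf : DifferentiableAt ℝ f (x + t * a, y + t * b)) :
    HasDerivAt (fun s : ℝ => f (x + s * a, y + s * b))
      (a * ∂₁ f (x + t * a, y + t * b) + b * ∂₂ f (x + t * a, y + t * b)) t := by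
  have hline : HasDerivAt (fun s : ℝ => (x + s * a, y + s * b)) (a, b) t := by
    have h (c d : ℝ) : HasDerivAt (fun s : ℝ => c + s * d) d t := by
      simpa using ((hasDerivAt_id t).mul_const d).const_add c
    exact (h x a).prodMk (h y b)
  have := hf.hasFDerivAt.comp_hasDerivAt t hline
  rwa [fderiv_apply_eq_dirDeriv] at this

lemma hasDerivAt_comp_line_snd {f₁ f₂ : ℝ × ℝ → ℝ} {x y a b t : ℝ}
    (h₁ : DifferentiableAt ℝ f₁ (x + t * a, y + t * b))
    (h₂ : DifferentiableAt ℝ f₂ (x + t * a, y + t * b)) :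
    HasDerivAt (fun s : ℝ => a * f₁ (x + s * a, y + s * b) + b * f₂ (x + s * a, y + s * b))
      (a * (a * ∂₁ f₁ (x + t * a, y + t * b) + b * ∂₂ f₁ (x + t * a, y + t * b)) +
        b * (a * ∂₁ f₂ (x + t * a, y + t * b) + b * ∂₂ f₂ (x + t * a, y + t * b))) t :=
  ((hasDerivAt_comp_line h₁).const_mul a).add ((hasDerivAt_comp_line h₂).const_mul b)

lemma dirDeriv_comm {f : ℝ × ℝ → ℝ} {p : ℝ × ℝ} (hf : ContDiffAt ℝ 2 f p) (v w : ℝ × ℝ) :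
    dirDeriv v (dirDeriv w f) p = dirDeriv w (dirDeriv v f) p := by
  have hd : DifferentiableAt ℝ (fderiv ℝ f) p :=
    (hf.fderiv_right (m := 1) (by norm_num)).differentiableAt (by norm_num)
  have h (u z : ℝ × ℝ) : dirDeriv u (dirDeriv z f) p = fderiv ℝ (fderiv ℝ f) p u z := by
    have := hd.hasFDerivAt.clm_apply (hasFDerivAt_const z p)
    change fderiv ℝ (fun q => fderiv ℝ f q z) p u = _
    rw [this.fderiv]
    simp
  rw [h, h]
  exact (hf.isSymmSndFDerivAt (by simp)).eq v w

lemma dirDeriv_sum_sq {g h : ℝ × ℝ → ℝ} {p : ℝ × ℝ} (hg : DifferentiableAt ℝ g p)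
    (hh : DifferentiableAt ℝ h p) (w : ℝ × ℝ) :
    dirDeriv w (fun q => g q ^ 2 + h q ^ 2) p
      = 2 * (g p * dirDeriv w g p + h p * dirDeriv w h p) := by
  have := (hg.hasFDerivAt.pow 2).add (hh.hasFDerivAt.pow 2)
  unfold dirDeriv
  rw [HasFDerivAt.fderiv (f := fun q => g q ^ 2 + h q ^ 2) this]
  simp
  ring

lemma dirDeriv_two_mul_add_mul {g h k l : ℝ × ℝ → ℝ} {p : ℝ × ℝ} (hg : DifferentiableAt ℝ g p)
    (hh : DifferentiableAt ℝ h p) (hk : DifferentiableAt ℝ k p) (hl : DifferentiableAt ℝ l p)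
    (w : ℝ × ℝ) :
    dirDeriv w (fun q => 2 * (g q * k q + h q * l q)) p
      = 2 * (dirDeriv w g p * k p + g p * dirDeriv w k p +
        (dirDeriv w h p * l p + h p * dirDeriv w l p)) := by
  have := ((hg.hasFDerivAt.mul hk.hasFDerivAt).add (hh.hasFDerivAt.mul hl.hasFDerivAt)).const_mul 2
  unfold dirDeriv
  rw [HasFDerivAt.fderiv (f := fun q => 2 * (g q * k q + h q * l q)) this]
  simp
  ring

lemma dirDeriv_dirDeriv_sum_sq {g h : ℝ × ℝ → ℝ} {Ω : Set (ℝ × ℝ)} {p : ℝ × ℝ} (hΩ : IsOpen Ω)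
    (hp : p ∈ Ω) (hg : ContDiffOn ℝ 2 g Ω) (hh : ContDiffOn ℝ 2 h Ω) (v w : ℝ × ℝ) :
    dirDeriv v (dirDeriv w (fun q => g q ^ 2 + h q ^ 2)) p
      = 2 * (dirDeriv v g p * dirDeriv w g p + g p * dirDeriv v (dirDeriv w g) p +
        (dirDeriv v h p * dirDeriv w h p + h p * dirDeriv v (dirDeriv w h) p)) := by
  have diff {k : ℝ × ℝ → ℝ} {n : WithTop ℕ∞} (hk : ContDiffOn ℝ n k Ω) (hn : n ≠ 0) {q : ℝ × ℝ}
      (hq : q ∈ Ω) : DifferentiableAt ℝ k q :=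
    (hk.contDiffAt (hΩ.mem_nhds hq)).differentiableAt hn
  have heq : dirDeriv w (fun q => g q ^ 2 + h q ^ 2) =ᶠ[𝓝 p]
      fun q => 2 * (g q * dirDeriv w g q + h q * dirDeriv w h q) := by
    filter_upwards [hΩ.mem_nhds hp] with q hq
    exact dirDeriv_sum_sq (diff hg (by norm_num) hq) (diff hh (by norm_num) hq) w
  have hg' : ContDiffOn ℝ 1 (dirDeriv w g) Ω := hg.dirDeriv hΩ (by norm_num) w
  have hh' : ContDiffOn ℝ 1 (dirDeriv w h) Ω := hh.dirDeriv hΩ (by norm_num) w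
  rw [← dirDeriv_two_mul_add_mul (diff hg (by norm_num) hp) (diff hh (by norm_num) hp)
    (diff hg' (by norm_num) hp) (diff hh' (by norm_num) hp) v]
  unfold dirDeriv at heq ⊢
  rw [heq.fderiv_eq]


/-- Along a `C²` function with negative tangential Hessian, an interior minimum along a nontrivial
segment cannot lie below both endpoint values. -/
lemma one_le_on_segment {v : ℝ × ℝ → ℝ} {Ω : Set (ℝ × ℝ)} (hΩ : IsOpen Ω)
    (hv : ContDiffOn ℝ 2 v Ω) {x y a b : ℝ} (ha : a ≠ 0)
    (hseg : ∀ t ∈ Set.Icc (0 : ℝ) 1, (x + t * a, y + t * b) ∈ Ω)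
    (hy : ∀ t ∈ Set.Icc (0 : ℝ) 1, 0 < ∂₂ v (x + t * a, y + t * b))
    (hQ : ∀ t ∈ Set.Icc (0 : ℝ) 1, ∀ p, p = (x + t * a, y + t * b) →
      ∂₁ (∂₁ v) p * ∂₂ v p ^ 2 - (∂₁ (∂₂ v) p + ∂₂ (∂₁ v) p) * ∂₁ v p * ∂₂ v p
        + ∂₂ (∂₂ v) p * ∂₁ v p ^ 2 < 0)
    (h0 : 1 ≤ v (x, y)) (h1 : 1 ≤ v (x + a, y + b)) {t : ℝ} (ht : t ∈ Set.Icc (0 : ℝ) 1) :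
    1 ≤ v (x + t * a, y + t * b) := by
  have diff {k : ℝ × ℝ → ℝ} {n : WithTop ℕ∞} (hk : ContDiffOn ℝ n k Ω) (hn : n ≠ 0) {q : ℝ × ℝ}
      (hq : q ∈ Ω) : DifferentiableAt ℝ k q :=
    (hk.contDiffAt (hΩ.mem_nhds hq)).differentiableAt hn
  have hv₁ : ContDiffOn ℝ 1 (∂₁ v) Ω := hv.dirDeriv hΩ (by norm_num) _
  have hv₂ : ContDiffOn ℝ 1 (∂₂ v) Ω := hv.dirDeriv hΩ (by norm_num) _
  set φ : ℝ → ℝ := fun s => v (x + s * a, y + s * b) with hφ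
  have hφ' {s : ℝ} (hs : (x + s * a, y + s * b) ∈ Ω) := hasDerivAt_comp_line
    (diff hv (by norm_num) hs)
  have hφ'' {s : ℝ} (hs : (x + s * a, y + s * b) ∈ Ω) := hasDerivAt_comp_line_snd
    (diff hv₁ (by norm_num) hs) (diff hv₂ (by norm_num) hs)
  have hcont : ContinuousOn φ (Set.Icc 0 1) := fun s hs =>
    (hφ' (hseg s hs)).continuousAt.continuousWithinAt
  obtain ⟨τ, hτ, hmin⟩ := isCompact_Icc.exists_isMinOn ⟨t, ht⟩ hcont
  refine le_trans ?_ (hmin ht)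
  by_contra! hlt
  have hτ0 : τ ≠ 0 := by
    rintro rfl
    simp [hφ] at hlt
    linarith
  have hτ1 : τ ≠ 1 := by
    rintro rfl
    simp [hφ] at hlt
    linarith
  have hτ' : τ ∈ Set.Ioo (0 : ℝ) 1 := ⟨hτ.1.lt_of_ne' hτ0, hτ.2.lt_of_ne hτ1⟩
  have hloc : IsLocalMin φ τ := hmin.isLocalMin (Icc_mem_nhds hτ'.1 hτ'.2)
  have hcrit := hloc.hasDerivAt_eq_zero (hφ' (hseg τ hτ))
  refine not_isLocalMin_of_second_deriv_neg ?_ (hφ'' (hseg τ hτ)) ?_ hloc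
  · filter_upwards [Ioo_mem_nhds hτ'.1 hτ'.2] with s hs using hφ' (hseg s ⟨hs.1.le, hs.2.le⟩)
  · have hq := hQ τ hτ _ rfl
    have hpos := hy τ hτ
    set p : ℝ × ℝ := (x + τ * a, y + τ * b)
    have hb : b = -(a * ∂₁ v p) / ∂₂ v p := by
      field_simp
      linarith
    have : a * (a * ∂₁ (∂₁ v) p + b * ∂₂ (∂₁ v) p) + b * (a * ∂₁ (∂₂ v) p + b * ∂₂ (∂₂ v) p)
        = a ^ 2 / ∂₂ v p ^ 2 * (∂₁ (∂₁ v) p * ∂₂ v p ^ 2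
          - (∂₁ (∂₂ v) p + ∂₂ (∂₁ v) p) * ∂₁ v p * ∂₂ v p + ∂₂ (∂₂ v) p * ∂₁ v p ^ 2) := by
      rw [hb]
      field_simp
      ring
    rw [this]
    exact mul_neg_of_pos_of_neg (by positivity) hq

/-- If `v` is `C²` with `v(0) = 1`, increasing in the second variable, and its Hessian is negative
along the level set at `0`, then `{v > 1}` is near `0` the strict supergraph of a convex function. -/
lemma exists_convexOn_supergraph {v : ℝ × ℝ → ℝ} {Ω : Set (ℝ × ℝ)} (hΩ : IsOpen Ω)
    (h0Ω : ((0 : ℝ), (0 : ℝ)) ∈ Ω) (hv : ContDiffOn ℝ 2 v Ω) (hv0 : v (0, 0) = 1)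
    (hy : 0 < ∂₂ v (0, 0))
    (hQ : ∂₁ (∂₁ v) (0, 0) * ∂₂ v (0, 0) ^ 2
      - (∂₁ (∂₂ v) (0, 0) + ∂₂ (∂₁ v) (0, 0)) * ∂₁ v (0, 0) * ∂₂ v (0, 0)
        + ∂₂ (∂₂ v) (0, 0) * ∂₁ v (0, 0) ^ 2 < 0) :
    ∃ δ > (0 : ℝ), ∃ a > (0 : ℝ), ∃ g : ℝ → ℝ,
      Set.Ioo (-δ) δ ×ˢ Set.Ioo (-a) a ⊆ Ω ∧
      ConvexOn ℝ (Set.Ioo (-δ) δ) g ∧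
      g 0 = 0 ∧
      (∀ x ∈ Set.Ioo (-δ) δ, g x ∈ Set.Ioo (-a) a) ∧
      (∀ x y : ℝ, x ∈ Set.Ioo (-δ) δ → y ∈ Set.Ioo (-a) a → (1 < v (x, y) ↔ g x < y)) := by
  have cont {k : ℝ × ℝ → ℝ} {n : WithTop ℕ∞} (hk : ContDiffOn ℝ n k Ω) {q : ℝ × ℝ}
      (hq : q ∈ Ω) : ContinuousAt k q := (hk.contDiffAt (hΩ.mem_nhds hq)).continuousAt
  have hv₁ : ContDiffOn ℝ 1 (∂₁ v) Ω := hv.dirDeriv hΩ (by norm_num) _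
  have hv₂ : ContDiffOn ℝ 1 (∂₂ v) Ω := hv.dirDeriv hΩ (by norm_num) _
  have hv₁₁ : ContDiffOn ℝ 0 (∂₁ (∂₁ v)) Ω := hv₁.dirDeriv hΩ (by norm_num) _
  have hv₂₁ : ContDiffOn ℝ 0 (∂₂ (∂₁ v)) Ω := hv₁.dirDeriv hΩ (by norm_num) _
  have hv₁₂ : ContDiffOn ℝ 0 (∂₁ (∂₂ v)) Ω := hv₂.dirDeriv hΩ (by norm_num) _
  have hv₂₂ : ContDiffOn ℝ 0 (∂₂ (∂₂ v)) Ω := hv₂.dirDeriv hΩ (by norm_num) _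
  have hQc : ContinuousAt (fun p => ∂₁ (∂₁ v) p * ∂₂ v p ^ 2
      - (∂₁ (∂₂ v) p + ∂₂ (∂₁ v) p) * ∂₁ v p * ∂₂ v p + ∂₂ (∂₂ v) p * ∂₁ v p ^ 2) (0, 0) :=
    (((cont hv₁₁ h0Ω).mul ((cont hv₂ h0Ω).pow 2)).sub
      ((((cont hv₁₂ h0Ω).add (cont hv₂₁ h0Ω)).mul (cont hv₁ h0Ω)).mul (cont hv₂ h0Ω))).add
      ((cont hv₂₂ h0Ω).mul ((cont hv₁ h0Ω).pow 2))
  have hev := (hΩ.eventually_mem h0Ω).and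
    (((cont hv₂ h0Ω).eventually_const_lt hy).and (hQc.eventually_lt_const hQ))
  obtain ⟨r, hr, hball⟩ := Metric.eventually_nhds_iff_ball.1 hev
  have hbox {x y : ℝ} (hx : |x| < r) (hy : |y| < r) :=
    hball (x, y) (by simpa [Prod.dist_eq, Real.dist_eq] using ⟨hx, hy⟩)
  set a := r / 2 with ha
  have ha0 : 0 < a := by positivity
  have har : a < r := by linarith
  have abs_lt_r {y : ℝ} (hy : y ∈ Set.Icc (-a) a) : |y| < r := by
    rw [abs_lt]; constructor <;> linarith [hy.1, hy.2]
  have hderiv {x y : ℝ} (hx : |x| < r) (hy : |y| < r) :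
      HasDerivAt (fun s => v (x, s)) (∂₂ v (x, y)) y := by
    have hd : DifferentiableAt ℝ v (x + y * 0, 0 + y * 1) := by
      simpa using (hv.contDiffAt (hΩ.mem_nhds (hbox hx hy).1)).differentiableAt (by norm_num)
    simpa using hasDerivAt_comp_line hd
  have hcont {x : ℝ} (hx : |x| < r) : ContinuousOn (fun s => v (x, s)) (Set.Icc (-a) a) :=
    fun y hy => (hderiv hx (abs_lt_r hy)).continuousAt.continuousWithinAt
  have hmono {x : ℝ} (hx : |x| < r) : StrictMonoOn (fun s => v (x, s)) (Set.Icc (-a) a) := by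
    refine strictMonoOn_of_deriv_pos (convex_Icc _ _) (hcont hx) fun y hy => ?_
    have hy' := abs_lt_r (interior_subset hy)
    rw [(hderiv hx hy').deriv]
    exact (hbox hx hy').2.1
  have mem0 : (0 : ℝ) ∈ Set.Icc (-a) a := ⟨by linarith, ha0.le⟩
  have mema : a ∈ Set.Icc (-a) a := ⟨by linarith, le_rfl⟩
  have memna : -a ∈ Set.Icc (-a) a := ⟨le_rfl, by linarith⟩
  have hr0 : |(0 : ℝ)| < r := by simpa using hr
  have htop : 1 < v (0, a) := hv0 ▸ hmono hr0 mem0 mema ha0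
  have hbot : v (0, -a) < 1 := hv0 ▸ hmono hr0 memna mem0 (by linarith)
  have hslice {c : ℝ} (hc : c ∈ Set.Icc (-a) a) : ContinuousAt (fun x : ℝ => v (x, c)) 0 :=
    ContinuousAt.comp (g := v) (f := fun x : ℝ => (x, c))
      (cont hv (hbox hr0 (abs_lt_r hc)).1) (by fun_prop)
  obtain ⟨ε, hε, hends⟩ := Metric.eventually_nhds_iff_ball.1
    (((hslice mema).eventually_const_lt htop).and ((hslice memna).eventually_lt_const hbot))
  set δ := min ε a
  have hδ0 : 0 < δ := lt_min hε ha0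
  have hδr {x : ℝ} (hx : x ∈ Set.Ioo (-δ) δ) : |x| < r :=
    (abs_lt.2 hx).trans_le ((min_le_right _ _).trans har.le)
  have hex (x : ℝ) (hx : x ∈ Set.Ioo (-δ) δ) : ∃ y ∈ Set.Ioo (-a) a, v (x, y) = 1 := by
    have hxε := hends x (by
      simpa [Real.dist_eq] using (abs_lt.2 hx).trans_le (min_le_left _ _))
    exact intermediate_value_Ioo (by linarith) (hcont (hδr hx)) ⟨hxε.2, hxε.1⟩
  choose! g hg hg1 using hex
  have hlt {x y : ℝ} (hx : x ∈ Set.Ioo (-δ) δ) (hy : y ∈ Set.Ioo (-a) a) :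
      1 < v (x, y) ↔ g x < y := by
    rw [← hg1 x hx]
    exact (hmono (hδr hx)).lt_iff_lt (Set.Ioo_subset_Icc_self (hg x hx))
      (Set.Ioo_subset_Icc_self hy)
  have hle {x y : ℝ} (hx : x ∈ Set.Ioo (-δ) δ) (hy : y ∈ Set.Ioo (-a) a) :
      1 ≤ v (x, y) ↔ g x ≤ y := by
    rw [← hg1 x hx]
    exact (hmono (hδr hx)).le_iff_le (Set.Ioo_subset_Icc_self (hg x hx))
      (Set.Ioo_subset_Icc_self hy)
  have h0δ : (0 : ℝ) ∈ Set.Ioo (-δ) δ := ⟨by linarith, hδ0⟩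
  refine ⟨δ, hδ0, a, ha0, g, ?_, ?_, ?_, hg, fun x y hx hy => hlt hx hy⟩
  · rintro ⟨x, y⟩ ⟨hx, hy⟩
    exact (hbox (hδr hx) (abs_lt_r (Set.Ioo_subset_Icc_self hy))).1
  · refine LinearOrder.convexOn_of_lt (convex_Ioo _ _) fun x₁ hx₁ x₂ hx₂ hx s t hs ht hst => ?_
    have hpt (τ : ℝ) (hτ : τ ∈ Set.Icc (0 : ℝ) 1) :
        x₁ + τ * (x₂ - x₁) ∈ Set.Ioo (-δ) δ ∧ g x₁ + τ * (g x₂ - g x₁) ∈ Set.Ioo (-a) a := by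
      have hseg {c c₁ c₂ : ℝ} (h₁ : c₁ ∈ Set.Ioo (-c) c) (h₂ : c₂ ∈ Set.Ioo (-c) c) :
          c₁ + τ * (c₂ - c₁) ∈ Set.Ioo (-c) c := by
        have := convex_Ioo (-c) c h₁ h₂ (sub_nonneg.2 hτ.2) hτ.1 (by ring)
        convert this using 1
        simp; ring
      exact ⟨hseg hx₁ hx₂, hseg (hg x₁ hx₁) (hg x₂ hx₂)⟩
    have hbox' (τ : ℝ) (hτ : τ ∈ Set.Icc (0 : ℝ) 1) := hbox (hδr (hpt τ hτ).1)
      (abs_lt_r (Set.Ioo_subset_Icc_self (hpt τ hτ).2))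
    have htI : t ∈ Set.Icc (0 : ℝ) 1 := ⟨ht.le, by linarith⟩
    have key := one_le_on_segment hΩ hv (sub_pos.2 hx).ne' (fun τ hτ => (hbox' τ hτ).1)
      (fun τ hτ => (hbox' τ hτ).2.1) (by rintro τ hτ _ rfl; exact (hbox' τ hτ).2.2)
      (hg1 x₁ hx₁).ge (by simpa using (hg1 x₂ hx₂).ge) htI
    obtain rfl : s = 1 - t := by linarith
    have hcomb (c₁ c₂ : ℝ) : (1 - t) • c₁ + t • c₂ = c₁ + t * (c₂ - c₁) := by
      simp only [smul_eq_mul]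
      ring
    rw [hcomb, hcomb]
    exact (hle (hpt t htI).1 (hpt t htI).2).1 key
  · refine (hmono hr0).injOn (Set.Ioo_subset_Icc_self (hg 0 h0δ)) mem0 ?_
    simp [hg1 0 h0δ, hv0]

/-- The partial derivatives at the origin of a `C³` function with a given third-order expansion
along every line through the origin. -/
lemma partials_of_cubic_expansion {f : ℝ × ℝ → ℝ} {Ω : Set (ℝ × ℝ)} (hΩ : IsOpen Ω)
    (h0 : ((0 : ℝ), (0 : ℝ)) ∈ Ω) (hf : ContDiffOn ℝ 3 f Ω) {c k₁ k₂ h₁ h₂ : ℝ}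
    (hexp : (fun p : ℝ × ℝ => f p - (c * p.1 + c * p.2 + k₁ * p.1 ^ 2 + k₂ * p.2 ^ 2 +
          h₁ * p.1 ^ 3 + h₂ * p.2 ^ 3)) =o[𝓝 ((0 : ℝ), (0 : ℝ))]
        fun p : ℝ × ℝ => (p.1 ^ 2 + p.2 ^ 2) ^ ((3 : ℝ) / 2)) :
    ∀ o : ℝ × ℝ, o = (0, 0) →
    (∂₁ f o = c ∧ ∂₂ f o = c) ∧
    (∂₁ (∂₁ f) o = 2 * k₁ ∧ ∂₁ (∂₂ f) o = 0 ∧ ∂₂ (∂₁ f) o = 0 ∧ ∂₂ (∂₂ f) o = 2 * k₂) ∧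
    (∂₁ (∂₁ (∂₁ f)) o = 6 * h₁ ∧ ∂₁ (∂₁ (∂₂ f)) o = 0 ∧ ∂₁ (∂₂ (∂₁ f)) o = 0 ∧
      ∂₁ (∂₂ (∂₂ f)) o = 0 ∧ ∂₂ (∂₁ (∂₁ f)) o = 0 ∧ ∂₂ (∂₁ (∂₂ f)) o = 0 ∧
      ∂₂ (∂₂ (∂₁ f)) o = 0 ∧ ∂₂ (∂₂ (∂₂ f)) o = 6 * h₂) := by
  rintro o rfl
  have diff {k : ℝ × ℝ → ℝ} {n : WithTop ℕ∞} (hk : ContDiffOn ℝ n k Ω) (hn : n ≠ 0) {q : ℝ × ℝ}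
      (hq : q ∈ Ω) : DifferentiableAt ℝ k q :=
    (hk.contDiffAt (hΩ.mem_nhds hq)).differentiableAt hn
  have hf' (w : ℝ × ℝ) : ContDiffOn ℝ 2 (dirDeriv w f) Ω := hf.dirDeriv hΩ (by norm_num) _
  have hf'' (u w : ℝ × ℝ) : ContDiffOn ℝ 1 (dirDeriv u (dirDeriv w f)) Ω :=
    (hf' w).dirDeriv hΩ (by norm_num) _
  have comm₂ : ∀ p ∈ Ω, ∂₁ (∂₂ f) p = ∂₂ (∂₁ f) p := fun p hp =>
    dirDeriv_comm ((hf.contDiffAt (hΩ.mem_nhds hp)).of_le (by norm_num)) _ _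
  have comm₃ (w : ℝ × ℝ) : dirDeriv w (∂₁ (∂₂ f)) (0, 0) = dirDeriv w (∂₂ (∂₁ f)) (0, 0) := by
    have : ∂₁ (∂₂ f) =ᶠ[𝓝 ((0 : ℝ), (0 : ℝ))] ∂₂ (∂₁ f) := by
      filter_upwards [hΩ.mem_nhds h0] with p hp using comm₂ p hp
    change fderiv ℝ _ _ _ = fderiv ℝ _ _ _
    rw [this.fderiv_eq]
  have comm₃' (w : ℝ × ℝ) :
      ∂₁ (∂₂ (dirDeriv w f)) (0, 0) = ∂₂ (∂₁ (dirDeriv w f)) (0, 0) :=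
    dirDeriv_comm ((hf' w).contDiffAt (hΩ.mem_nhds h0)) _ _
  have line (a b : ℝ) : (a * ∂₁ f (0, 0) + b * ∂₂ f (0, 0) = c * a + c * b) ∧
      (a * (a * ∂₁ (∂₁ f) (0, 0) + b * ∂₂ (∂₁ f) (0, 0)) +
        b * (a * ∂₁ (∂₂ f) (0, 0) + b * ∂₂ (∂₂ f) (0, 0)) = 2 * (k₁ * a ^ 2 + k₂ * b ^ 2)) ∧
      (a * (a * (a * ∂₁ (∂₁ (∂₁ f)) (0, 0) + b * ∂₂ (∂₁ (∂₁ f)) (0, 0)) +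
          b * (a * ∂₁ (∂₂ (∂₁ f)) (0, 0) + b * ∂₂ (∂₂ (∂₁ f)) (0, 0))) +
        b * (a * (a * ∂₁ (∂₁ (∂₂ f)) (0, 0) + b * ∂₂ (∂₁ (∂₂ f)) (0, 0)) +
          b * (a * ∂₁ (∂₂ (∂₂ f)) (0, 0) + b * ∂₂ (∂₂ (∂₂ f)) (0, 0)))
        = 6 * (h₁ * a ^ 3 + h₂ * b ^ 3)) := by
    have hlim : Tendsto (fun t : ℝ => (0 + t * a, 0 + t * b)) (𝓝 0) (𝓝 ((0 : ℝ), (0 : ℝ))) := by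
      have : Continuous fun t : ℝ => (0 + t * a, 0 + t * b) := by fun_prop
      simpa using this.tendsto 0
    have hmem : ∀ᶠ t : ℝ in 𝓝 0, (0 + t * a, 0 + t * b) ∈ Ω := hlim (hΩ.mem_nhds h0)
    have h0' : (0 + (0 : ℝ) * a, 0 + (0 : ℝ) * b) ∈ Ω := hmem.self_of_nhds
    have hcomp := hexp.comp_tendsto hlim
    have hbig : ((fun p : ℝ × ℝ => (p.1 ^ 2 + p.2 ^ 2) ^ ((3 : ℝ) / 2)) ∘
        fun t : ℝ => (0 + t * a, 0 + t * b)) =O[𝓝 0] fun t : ℝ => t ^ 3 := by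
      refine IsBigO.of_bound ((a ^ 2 + b ^ 2) ^ ((3 : ℝ) / 2)) (Eventually.of_forall fun t => ?_)
      have habs : (t ^ 2) ^ ((3 : ℝ) / 2) = |t| ^ 3 := by
        rw [← sq_abs, ← Real.rpow_natCast, ← Real.rpow_mul (abs_nonneg t)]
        norm_num
      have : (0 + t * a) ^ 2 + (0 + t * b) ^ 2 = (a ^ 2 + b ^ 2) * t ^ 2 := by ring
      simp only [Function.comp, this]
      rw [Real.mul_rpow (by positivity) (by positivity), habs,
        Real.norm_of_nonneg (by positivity), norm_pow, Real.norm_eq_abs]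
    have hlittle := hcomp.trans_isBigO hbig
    have h := derivs_eq_of_cubic_expansion (c₁ := c * a + c * b) (c₂ := k₁ * a ^ 2 + k₂ * b ^ 2)
      (c₃ := h₁ * a ^ 3 + h₂ * b ^ 3)
      (hmem.mono fun t ht => hasDerivAt_comp_line (diff hf (by norm_num) ht))
      (hmem.mono fun t ht => hasDerivAt_comp_line_snd (diff (hf' _) (by norm_num) ht)
        (diff (hf' _) (by norm_num) ht))
      (((hasDerivAt_comp_line_snd (diff (hf'' _ _) (by norm_num) h0')
          (diff (hf'' _ _) (by norm_num) h0')).const_mul a).add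
        ((hasDerivAt_comp_line_snd (diff (hf'' _ _) (by norm_num) h0')
          (diff (hf'' _ _) (by norm_num) h0')).const_mul b))
      (hlittle.congr_left fun t => by simp only [Function.comp]; ring)
    simpa only [zero_mul, add_zero] using h
  obtain ⟨a1, a2, a3⟩ := line 1 0
  obtain ⟨b1, b2, b3⟩ := line 0 1
  obtain ⟨-, c2, c3⟩ := line 1 1
  obtain ⟨-, -, d3⟩ := line 1 (-1)
  have e2 := comm₂ _ h0
  have e31 := comm₃ (1, 0)
  have e32 := comm₃ (0, 1)
  have e33 := comm₃' (1, 0)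
  have e34 := comm₃' (0, 1)
  refine ⟨⟨?_, ?_⟩, ⟨?_, ?_, ?_, ?_⟩, ?_, ?_, ?_, ?_, ?_, ?_, ?_, ?_⟩ <;> linarith

/-- statement (1) of Theorem 1.4 / `thm:example`.
If `k₂ > 0` and `8k₁²k₂² + 3√2(k₁²h₂ + k₂²h₁) < 0`, then near the origin the
supercritical region `{|∇u₀| > 1}` of a `C³` function `u₀` with the given Taylor
expansion is the supergraph of a convex function `g` with `g(0) = 0`. -/
theorem supercritical_region_locally_convex_supergraph
    (k₁ k₂ h₁ h₂ : ℝ) (hk₂ : 0 < k₂)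
    (hconv : 8 * k₁ ^ 2 * k₂ ^ 2 + 3 * Real.sqrt 2 * (k₁ ^ 2 * h₂ + k₂ ^ 2 * h₁) < 0)
    (Ω : Set (ℝ × ℝ)) (hΩ : IsOpen Ω) (hΩ0 : ((0 : ℝ), (0 : ℝ)) ∈ Ω)
    (u₀ : ℝ → ℝ → ℝ)
    (hu₀C3 : ContDiffOn ℝ 3 (fun p : ℝ × ℝ => u₀ p.1 p.2) Ω)
    (htaylor : (fun p : ℝ × ℝ => u₀ p.1 p.2 -
        (Real.sqrt 2 / 2 * p.1 + Real.sqrt 2 / 2 * p.2 + k₁ * p.1 ^ 2 + k₂ * p.2 ^ 2 +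
          h₁ * p.1 ^ 3 + h₂ * p.2 ^ 3)) =o[nhds ((0 : ℝ), (0 : ℝ))]
        fun p : ℝ × ℝ => (p.1 ^ 2 + p.2 ^ 2) ^ ((3 : ℝ) / 2)) :
    ∃ δ > (0 : ℝ), ∃ a > (0 : ℝ), ∃ g : ℝ → ℝ,
      Set.Ioo (-δ) δ ×ˢ Set.Ioo (-a) a ⊆ Ω ∧
      ConvexOn ℝ (Set.Ioo (-δ) δ) g ∧
      g 0 = 0 ∧
      (∀ x ∈ Set.Ioo (-δ) δ, g x ∈ Set.Ioo (-a) a) ∧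
      (∀ x y : ℝ, x ∈ Set.Ioo (-δ) δ → y ∈ Set.Ioo (-a) a →
        (1 < gradSq0 u₀ x y ↔ g x < y)) := by
  set f : ℝ × ℝ → ℝ := fun p => u₀ p.1 p.2
  set v : ℝ × ℝ → ℝ := fun p => ∂₁ f p ^ 2 + ∂₂ f p ^ 2 with hv
  have hf₁ : ContDiffOn ℝ 2 (∂₁ f) Ω := hu₀C3.dirDeriv hΩ (by norm_num) _
  have hf₂ : ContDiffOn ℝ 2 (∂₂ f) Ω := hu₀C3.dirDeriv hΩ (by norm_num) _
  have hvC2 : ContDiffOn ℝ 2 v Ω := (hf₁.pow 2).add (hf₂.pow 2)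
  have hgrad {x y : ℝ} (hp : (x, y) ∈ Ω) : gradSq0 u₀ x y = v (x, y) := by
    have hd : DifferentiableAt ℝ f (x, y) :=
      (hu₀C3.contDiffAt (hΩ.mem_nhds hp)).differentiableAt (by norm_num)
    have hx : HasDerivAt (fun s => u₀ s y) (∂₁ f (x, y)) x := by
      have hd' : DifferentiableAt ℝ f (0 + x * 1, y + x * 0) := by simpa using hd
      simpa [f] using hasDerivAt_comp_line hd'
    have hy : HasDerivAt (fun s => u₀ x s) (∂₂ f (x, y)) y := by
      have hd' : DifferentiableAt ℝ f (x + y * 0, 0 + y * 1) := by simpa using hd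
      simpa [f] using hasDerivAt_comp_line hd'
    rw [gradSq0, hx.deriv, hy.deriv]
  obtain ⟨⟨p1, p2⟩, ⟨p11, p12, p21, p22⟩, p111, p112, p121, p122, p211, p212, p221, p222⟩ :=
    partials_of_cubic_expansion hΩ hΩ0 hu₀C3 htaylor _ rfl
  have hsqrt : Real.sqrt 2 * Real.sqrt 2 = 2 := Real.mul_self_sqrt (by norm_num)
  have d1 (w : ℝ × ℝ) : dirDeriv w v (0, 0) = _ := dirDeriv_sum_sq
    ((hf₁.contDiffAt (hΩ.mem_nhds hΩ0)).differentiableAt (by norm_num))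
    ((hf₂.contDiffAt (hΩ.mem_nhds hΩ0)).differentiableAt (by norm_num)) w
  have d2 (z w : ℝ × ℝ) : dirDeriv z (dirDeriv w v) (0, 0) = _ :=
    dirDeriv_dirDeriv_sum_sq hΩ hΩ0 hf₁ hf₂ z w
  obtain ⟨δ, hδ, a, ha, g, hsub, hconvex, hg0, hg, hiff⟩ :=
    exists_convexOn_supergraph (v := v) hΩ hΩ0 hvC2
      (by simp only [hv, p1, p2]; linear_combination hsqrt / 2)
      (by simp only [d1, p1, p2, p22]; ring_nf; positivity)
      (by
        simp only [d1, d2, p1, p2, p11, p12, p21, p22, p111, p112, p121, p122,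
          p211, p212, p221, p222]
        refine lt_of_eq_of_lt ?_ (mul_neg_of_pos_of_neg (by norm_num : (0 : ℝ) < 8 * 2) hconv)
        linear_combination (4 * k₂ ^ 2 * (8 * k₁ ^ 2 + 6 * Real.sqrt 2 * h₁)
          + 4 * k₁ ^ 2 * (8 * k₂ ^ 2 + 6 * Real.sqrt 2 * h₂)) * hsqrt)
  refine ⟨δ, hδ, a, ha, g, hsub, hconvex, hg0, hg, fun x y hx hy => ?_⟩
  rw [hgrad (hsub ⟨hx, hy⟩), hiff x y hx hy]
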